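/- Let p and q be probability vectors on {1,…,n} and let j ∈ {1,…,n} satisfy p_j > 0 and q_j > 0. Then min(p_j, q_j)·(1 + |p_j − q_j|) / Σ_{i=1}^n max(p_i, q_i) ≤ 1 / Σ_{i=1}^n max(p_i/p_j, q_i/q_j). -/

import Mathlib

/-- Cross-multiplied form of the comparison when the `j`-th weight of `p` is the smaller one. -/
theorem mul_sum_max_div_le_sum_max {ι : Type*} [Fintype ι] (p q : ι → ℝ)
    (hp0 : ∀ i, 0 ≤ p i) (hp1 : ∑ i, p i = 1) (hq0 : ∀ i, 0 ≤ q i)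
    (j : ι) (hpj : 0 < p j) (hpq : p j ≤ q j) :
    p j * (1 + (q j - p j)) * ∑ i, max (p i / p j) (q i / q j) ≤ ∑ i, max (p i) (q i) := by
  classical
  have hqj : 0 < q j := hpj.trans_le hpq
  have hpj1 : p j ≤ 1 := hp1 ▸ Finset.single_le_sum (fun i _ => hp0 i) (Finset.mem_univ j)
  have hd : 0 ≤ q j - p j := sub_nonneg.2 hpq
  have hterm (i : ι) : p j * (1 + (q j - p j)) * max (p i / p j) (q i / q j)
      ≤ max (p i) (q i) + (q j - p j) * p i - if i = j then q j - p j else 0 := by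
    split_ifs with hij
    · subst hij
      rw [div_self hpj.ne', div_self hqj.ne', max_self, max_eq_right hpq]
      linarith
    · rw [sub_zero]
      rcases le_total (q i / q j) (p i / p j) with h | h
      · rw [max_eq_left h]
        have hcancel : p j * (1 + (q j - p j)) * (p i / p j) = (1 + (q j - p j)) * p i := by
          field_simp
        rw [hcancel]
        linarith [le_max_left (p i) (q i)]
      · rw [max_eq_right h]
        have hcoef : p j * (1 + (q j - p j)) ≤ q j := by
          nlinarith [mul_nonneg hd (sub_nonneg.2 hpj1)]
        calc p j * (1 + (q j - p j)) * (q i / q j) ≤ q j * (q i / q j) :=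
              mul_le_mul_of_nonneg_right hcoef (div_nonneg (hq0 i) hqj.le)
          _ = q i := mul_div_cancel₀ _ hqj.ne'
          _ ≤ max (p i) (q i) + (q j - p j) * p i :=
              (le_max_right _ _).trans (le_add_of_nonneg_right (mul_nonneg hd (hp0 i)))
  calc p j * (1 + (q j - p j)) * ∑ i, max (p i / p j) (q i / q j)
      = ∑ i, p j * (1 + (q j - p j)) * max (p i / p j) (q i / q j) := Finset.mul_sum _ _ _
    _ ≤ ∑ i, (max (p i) (q i) + (q j - p j) * p i - if i = j then q j - p j else 0) :=
        Finset.sum_le_sum fun i _ => hterm i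
    _ = ∑ i, max (p i) (q i) := by
        rw [Finset.sum_sub_distrib, Finset.sum_add_distrib, ← Finset.mul_sum, hp1]
        simp


/-- Per-index comparison between Weighted MinHash and Gumbel sampling: for `j` with
`p j > 0` and `q j > 0`,
`min (p j) (q j) * (1 + |p j - q j|) / ∑ i, max (p i) (q i)
  ≤ 1 / ∑ i, max (p i / p j) (q i / q j)`. -/
theorem stmt_11 (n : ℕ) (p q : Fin n → ℝ)
    (hp0 : ∀ i, 0 ≤ p i) (hp1 : ∑ i, p i = 1)
    (hq0 : ∀ i, 0 ≤ q i) (hq1 : ∑ i, q i = 1)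
    (j : Fin n) (hpj : 0 < p j) (hqj : 0 < q j) :
    min (p j) (q j) * (1 + |p j - q j|) / ∑ i, max (p i) (q i)
      ≤ 1 / ∑ i, max (p i / p j) (q i / q j) := by
  have hM : 0 < ∑ i, max (p i) (q i) :=
    Finset.sum_pos' (fun i _ => (hp0 i).trans (le_max_left _ _))
      ⟨j, Finset.mem_univ j, hpj.trans_le (le_max_left _ _)⟩
  have hG : 0 < ∑ i, max (p i / p j) (q i / q j) :=
    Finset.sum_pos' (fun i _ => (div_nonneg (hp0 i) hpj.le).trans (le_max_left _ _))
      ⟨j, Finset.mem_univ j, (div_pos hpj hpj).trans_le (le_max_left _ _)⟩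
  rw [div_le_div_iff₀ hM hG, one_mul]
  rcases le_total (p j) (q j) with h | h
  · rw [min_eq_left h, abs_sub_comm, abs_of_nonneg (sub_nonneg.2 h)]
    exact mul_sum_max_div_le_sum_max p q hp0 hp1 hq0 j hpj h
  · rw [min_eq_right h, abs_of_nonneg (sub_nonneg.2 h)]
    simpa only [max_comm] using mul_sum_max_div_le_sum_max q p hq0 hq1 hp0 j hqj h
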